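/- Let α ∈ (0,1) be irrational, ρ ∈ [0,1), and let s = s_{α,ρ} be the Sturmian word of slope α and intercept ρ. Let ℓ ≥ 1, n ≥ ℓ, and let u, v ∈ {0,1}^ℓ be factors of s of length ℓ. Then (u,v) ∈ ∂_{s,ℓ}[n] if and only if there exists x ∈ [0,1) such that for every i < ℓ, u_i = 0 ⟺ {x + iα} ∈ [0, 1−α) and v_i = 0 ⟺ {x + (n+i)α} ∈ [0, 1−α) (i.e., R_α^n(I_u) ∩ I_v ≠ ∅, where I_w := {x ∈ [0,1) : ∀ i < ℓ, w_i = 0 ⟺ {x + iα} ∈ [0,1−α)}). -/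

import Mathlib

/-- The Sturmian word of slope `α` and intercept `ρ`:
`s[n] = 0` iff `{ρ + nα} ∈ [0, 1−α)`. -/
noncomputable def sturmian (α ρ : ℝ) (n : ℕ) : Fin 2 :=
  if Int.fract (ρ + n * α) < 1 - α then 0 else 1

/-- The `n`-th boundary set of the infinite word `x` with window length `ℓ`. -/
def boundarySet {A : Type*} (x : ℕ → A) (ℓ n : ℕ) :
    Set ((Fin ℓ → A) × (Fin ℓ → A)) :=
  {p | ∃ i : ℕ, (∀ k : Fin ℓ, p.1 k = x (i + k)) ∧ (∀ k : Fin ℓ, p.2 k = x (i + n + k))}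

open Filter Topology in
/-- Membership of the fractional part in `[0, b)` is locally constant from the right. -/
theorem eventually_nhdsGT_fract_lt_iff (b c x : ℝ) :
    ∀ᶠ t in 𝓝[>] x, (Int.fract (x + c) < b ↔ Int.fract (t + c) < b) := by
  have hfloor : ∀ t, x < t → t < x + (1 - Int.fract (x + c)) →
      Int.fract (t + c) = Int.fract (x + c) + (t - x) := by
    intro t hxt ht
    rw [Int.fract_eq_iff]
    refine ⟨by linarith [Int.fract_nonneg (x + c)], by linarith, ⌊x + c⌋, ?_⟩
    linarith [Int.floor_add_fract (x + c)]
  have hfract : 0 < 1 - Int.fract (x + c) := by linarith [Int.fract_lt_one (x + c)]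
  have hIoo := Ioo_mem_nhdsGT (show x < x + (1 - Int.fract (x + c)) by linarith)
  by_cases hb : Int.fract (x + c) < b
  · filter_upwards [hIoo, Ioo_mem_nhdsGT (show x < x + (b - Int.fract (x + c)) by linarith)]
      with t ht ht'
    exact iff_of_true hb (by linarith [hfloor t ht.1 ht.2, ht'.2])
  · filter_upwards [hIoo] with t ht
    exact iff_of_false hb (by linarith [hfloor t ht.1 ht.2, ht.1])

/-- The forward orbit of any point under an irrational rotation meets every open interval
modulo `1`. -/
theorem Irrational.exists_add_natCast_mul_add_intCast_mem_Ioo {α : ℝ} (hα : Irrational α)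
    (ρ : ℝ) {a b : ℝ} (hab : a < b) :
    ∃ (i : ℕ) (m : ℤ), ρ + i * α + m ∈ Set.Ioo a b := by
  have hdense : DenseRange (fun i : ℕ ↦ i • (α : AddCircle (1 : ℝ))) := by
    rw [← denseRange_zsmul_iff_nsmul, AddCircle.denseRange_zsmul_coe_iff, div_one]
    exact hα
  obtain ⟨y, ⟨i, hi⟩, hy⟩ := (QuotientAddGroup.dense_preimage_mk.2 hdense).exists_between
    (sub_lt_sub_right hab ρ)
  dsimp only at hi
  rw [← QuotientAddGroup.mk_nsmul, QuotientAddGroup.eq, AddSubgroup.mem_zmultiples_iff] at hi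
  obtain ⟨m, hm⟩ := hi
  simp only [nsmul_eq_mul, zsmul_eq_mul, mul_one] at hm
  exact ⟨i, m, by linarith [hy.1], by linarith [hy.2]⟩

theorem sturmian_eq_zero_iff {α ρ : ℝ} {n : ℕ} :
    sturmian α ρ n = 0 ↔ Int.fract (ρ + n * α) < 1 - α := by
  simp [sturmian, lt_sub_iff_add_lt]

theorem Fin.eq_iff_eq_zero_iff_eq_zero {a b : Fin 2} : a = b ↔ (a = 0 ↔ b = 0) := by
  lia

/-- The letters of a Sturmian word from position `i` on are read off from the orbit of any
representative modulo `1` of `ρ + iα`. -/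
theorem eq_sturmian_add_iff {α ρ x : ℝ} {i j : ℕ} {m : ℤ} (hx : x = ρ + i * α + m) {a : Fin 2} :
    a = sturmian α ρ (i + j) ↔ (a = 0 ↔ Int.fract (x + j * α) < 1 - α) := by
  have : x + j * α = ρ + (i + j : ℕ) * α + m := by
    rw [hx]; push_cast; ring
  rw [this, Int.fract_add_intCast, ← sturmian_eq_zero_iff, Fin.eq_iff_eq_zero_iff_eq_zero]

/-- for a Sturmian word `s` of irrational slope `α ∈ (0,1)` and intercept
`ρ`, and length-`ℓ` factors `u, v` of `s`, the pair `(u,v)` belongs to `∂_{s,ℓ}[n]`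
(`n ≥ ℓ ≥ 1`) iff there is `x ∈ [0,1)` with, for all `i < ℓ`,
`uᵢ = 0 ⟺ {x + iα} ∈ [0,1−α)` and `vᵢ = 0 ⟺ {x + (n+i)α} ∈ [0,1−α)`,
i.e. `R_α^n(I_u) ∩ I_v ≠ ∅`. -/
theorem stmt11 (α : ℝ) (hα0 : 0 < α) (hα1 : α < 1) (hirr : Irrational α)
    (ρ : ℝ) (hρ0 : 0 ≤ ρ) (hρ1 : ρ < 1)
    (ℓ n : ℕ) (hℓ : 1 ≤ ℓ) (hn : ℓ ≤ n)
    (u v : Fin ℓ → Fin 2)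
    (hu : ∃ i : ℕ, ∀ k : Fin ℓ, u k = sturmian α ρ (i + k))
    (hv : ∃ i : ℕ, ∀ k : Fin ℓ, v k = sturmian α ρ (i + k)) :
    (u, v) ∈ boundarySet (sturmian α ρ) ℓ n ↔
      ∃ x : ℝ, 0 ≤ x ∧ x < 1 ∧ ∀ i : Fin ℓ,
        (u i = 0 ↔ Int.fract (x + (i : ℕ) * α) < 1 - α) ∧
        (v i = 0 ↔ Int.fract (x + ((n : ℕ) + (i : ℕ)) * α) < 1 - α) := by
  constructor
  · rintro ⟨i, hiu, hiv⟩
    have hx : Int.fract (ρ + i * α) = ρ + i * α + (-⌊ρ + i * α⌋ : ℤ) := by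
      rw [Int.cast_neg, ← sub_eq_add_neg, Int.fract]
    refine ⟨_, Int.fract_nonneg (ρ + i * α), Int.fract_lt_one _, fun k ↦ ⟨?_, ?_⟩⟩
    · exact (eq_sturmian_add_iff hx).1 (hiu k)
    · have := (eq_sturmian_add_iff hx).1 ((hiv k).trans (by rw [add_assoc]))
      rwa [Nat.cast_add] at this
  · rintro ⟨x, -, -, hx⟩
    have hev := Filter.eventually_all.2 fun k : Fin ℓ ↦
      (eventually_nhdsGT_fract_lt_iff (1 - α) ((k : ℕ) * α) x).and
        (eventually_nhdsGT_fract_lt_iff (1 - α) (((n : ℕ) + (k : ℕ)) * α) x)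
    obtain ⟨b, hb, hxb⟩ := mem_nhdsGT_iff_exists_Ioo_subset.1 hev
    obtain ⟨i, m, him⟩ := hirr.exists_add_natCast_mul_add_intCast_mem_Ioo ρ hb
    have hfract := hxb him
    refine ⟨i, fun k ↦ ?_, fun k ↦ ?_⟩
    · exact (eq_sturmian_add_iff rfl).2 ((hx k).1.trans (hfract k).1)
    · rw [add_assoc, eq_sturmian_add_iff rfl, Nat.cast_add]
      exact (hx k).2.trans (hfract k).2
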